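/- Let u¹, u² : ℝ² → ℝ be smooth solutions of the G₂ Toda lattice ∂²u¹/∂x∂y = 2e^{u¹} − e^{u²}, ∂²u²/∂x∂y = −3e^{u¹} + 2e^{u²}. With G₂ = [[2,−1],[−3,2]], P = [[3,1],[0,1/3]], Q = [[1,0],[−1,1]], U = diag(e^{u¹}, e^{u²}), R₁ = diag(∂_y u¹, ∂_y u²), Z₂ = [[0,0],[−e^{u²}, e^{u¹}]] and S₂ = diag(0, e^{u¹+u²}), define H₂ := ∂_x(−G₂·R₁·G₂⁻¹) + G₂·U (∂_x applied entrywise). Then at every point H₂ = G₂·P⁻¹·Z₂·G₂⁻¹, and X₂ := H₂·(G₂·U) = G₂·P⁻¹·S₂·Q. -/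

import Mathlib

open Matrix

noncomputable section

/-- Entrywise partial derivative with respect to the first variable `x`. -/
def dxMat {n : ℕ} (F : ℝ × ℝ → Matrix (Fin n) (Fin n) ℝ) (p : ℝ × ℝ) :
    Matrix (Fin n) (Fin n) ℝ :=
  Matrix.of fun i j => deriv (fun s => F (s, p.2) i j) p.1

/-- Partial derivative of a scalar function with respect to `y`. -/
def dy (f : ℝ × ℝ → ℝ) (p : ℝ × ℝ) : ℝ := deriv (fun t => f (p.1, t)) p.2

/-- The Cartan matrix `G₂`. -/
def G2M : Matrix (Fin 2) (Fin 2) ℝ := !![2, -1; -3, 2]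

def PM : Matrix (Fin 2) (Fin 2) ℝ := !![3, 1; 0, 1/3]

def QM : Matrix (Fin 2) (Fin 2) ℝ := !![1, 0; -1, 1]

/-- The `y`-derivative of a smooth function is differentiable in `x`. -/
lemma differentiableAt_dy_fst {u : ℝ × ℝ → ℝ} (hu : ContDiff ℝ (⊤ : ℕ∞) u) (x y : ℝ) :
    DifferentiableAt ℝ (fun s => dy u (s, y)) x := by
  have key : (fun s => dy u (s, y)) = fun s => fderiv ℝ u (s, y) (0, 1) := by
    funext s
    have hline : HasDerivAt (fun t : ℝ => (s, t)) ((0 : ℝ), (1 : ℝ)) y :=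
      (hasDerivAt_const y s).prodMk (hasDerivAt_id y)
    exact ((hu.differentiable (by simp) (s, y)).hasFDerivAt.comp_hasDerivAt y hline).deriv
  rw [key]
  have hfd : Differentiable ℝ (fderiv ℝ u) :=
    (hu.fderiv_right (m := 1) (by norm_cast)).differentiable (by simp)
  have hpair : DifferentiableAt ℝ (fun s : ℝ => (s, y)) x := by fun_prop
  exact ((hfd (x, y)).comp x hpair).clm_apply (differentiableAt_const _)

lemma inv_G2M : G2M⁻¹ = !![2, 1; 3, 2] := by
  apply Matrix.inv_eq_right_inv
  ext i j
  fin_cases i <;> fin_cases j <;> norm_num [G2M, Matrix.mul_apply, Fin.sum_univ_two]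

lemma inv_PM : PM⁻¹ = !![1/3, -1; 0, 3] := by
  apply Matrix.inv_eq_right_inv
  ext i j
  fin_cases i <;> fin_cases j <;> norm_num [PM, Matrix.mul_apply, Fin.sum_univ_two]

/-- Entrywise differentiation commutes with conjugation of a diagonal matrix by `G₂`. -/
lemma dxMat_neg_conj_diagonal {f g : ℝ × ℝ → ℝ} {p : ℝ × ℝ} {a b : ℝ}
    (hf : HasDerivAt (fun s => f (s, p.2)) a p.1) (hg : HasDerivAt (fun s => g (s, p.2)) b p.1) :
    dxMat (fun q => -(G2M * Matrix.diagonal ![f q, g q] * G2M⁻¹)) p =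
      -(G2M * Matrix.diagonal ![a, b] * G2M⁻¹) := by
  have entry (i j : Fin 2) (v w : ℝ) : (-(G2M * Matrix.diagonal ![v, w] * G2M⁻¹)) i j =
      -(G2M i 0 * v * G2M⁻¹ 0 j + G2M i 1 * w * G2M⁻¹ 1 j) := by
    simp [Matrix.mul_apply, Fin.sum_univ_two]
  ext i j
  simp only [dxMat, Matrix.of_apply, entry]
  exact (((hf.const_mul _).mul_const _).add ((hg.const_mul _).mul_const _)).neg.deriv

/-- For smooth solutions of the `G₂` Toda lattice, the second Laplace invariant
`H₂ = ∂_x(−G₂R₁G₂⁻¹) + G₂U` equals `G₂P⁻¹Z₂G₂⁻¹`, and `X₂ = H₂·(G₂U) = G₂P⁻¹S₂Q`. -/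
theorem g2_second_laplace_invariant
    (u1 u2 : ℝ × ℝ → ℝ) (hu1 : ContDiff ℝ (⊤ : ℕ∞) u1) (hu2 : ContDiff ℝ (⊤ : ℕ∞) u2)
    (hpde1 : ∀ x y : ℝ, deriv (fun s => deriv (fun t => u1 (s, t)) y) x =
      2 * Real.exp (u1 (x, y)) - Real.exp (u2 (x, y)))
    (hpde2 : ∀ x y : ℝ, deriv (fun s => deriv (fun t => u2 (s, t)) y) x =
      -3 * Real.exp (u1 (x, y)) + 2 * Real.exp (u2 (x, y))) :
    ∀ p : ℝ × ℝ,
      dxMat (fun q => -(G2M * Matrix.diagonal ![dy u1 q, dy u2 q] * G2M⁻¹)) p +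
          G2M * Matrix.diagonal ![Real.exp (u1 p), Real.exp (u2 p)] =
        G2M * PM⁻¹ * !![0, 0; -Real.exp (u2 p), Real.exp (u1 p)] * G2M⁻¹ ∧
      (dxMat (fun q => -(G2M * Matrix.diagonal ![dy u1 q, dy u2 q] * G2M⁻¹)) p +
          G2M * Matrix.diagonal ![Real.exp (u1 p), Real.exp (u2 p)]) *
          (G2M * Matrix.diagonal ![Real.exp (u1 p), Real.exp (u2 p)]) =
        G2M * PM⁻¹ * Matrix.diagonal ![0, Real.exp (u1 p + u2 p)] * QM := by
  rintro ⟨x, y⟩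
  have h1 := (differentiableAt_dy_fst hu1 x y).hasDerivAt
  have h2 := (differentiableAt_dy_fst hu2 x y).hasDerivAt
  rw [show deriv (fun s => dy u1 (s, y)) x = _ from hpde1 x y] at h1
  rw [show deriv (fun s => dy u2 (s, y)) x = _ from hpde2 x y] at h2
  rw [dxMat_neg_conj_diagonal (p := (x, y)) h1 h2, inv_G2M, inv_PM, Real.exp_add]
  simp only [Matrix.diagonal_vec2]
  constructor <;> ext i j <;> fin_cases i <;> fin_cases j <;>
    simp [G2M, QM, Matrix.mul_apply, Fin.sum_univ_two] <;> ring

end
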